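/- arXiv:math/0604433 — 2 statements merged into one kernel-verified Lean document; each statement's English description precedes it below -/
import Mathlib

section
/- Let G be a countable discrete group equipped with the word metric d coming from a finite symmetric generating set, let μ be a probability measure on G, and let k > 0. Suppose X ⊆ G is k-separated, i.e. d(x, y) > k for all distinct x, y ∈ X. Then for all natural numbers m < n, μ^(n)(X) ≤ sup{ μ^(m)({g}) : g ∈ B_{k/2} } + μ^(m)(G ∖ B_{k/2}), where B_{k/2} = { g ∈ G : ∥g∥ ≤ k/2 } is the ball of radius k/2 about the identity in the word metric. -/
open ENNReal

/-- The word length of `g` with respect to a generating set `S`: the least `n` such that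
`g` is a product of `n` elements of `S`. -/
noncomputable def wordLength {G : Type*} [Group G] (S : Set G) (g : G) : ℕ :=
  sInf {n : ℕ | ∃ l : List G, (∀ x ∈ l, x ∈ S) ∧ l.length = n ∧ l.prod = g}

/-- The word metric `d(x,y) = ∥x⁻¹ y∥` associated to the generating set `S`. -/
noncomputable def wordDist {G : Type*} [Group G] (S : Set G) (x y : G) : ℕ :=
  wordLength S (x⁻¹ * y)

/-- The `n`-fold convolution `μ^(n)` of a probability distribution `μ` on a group `G`:
`μ^(0)` is the point mass at the identity, and
`μ^(n)(A) = Σ_g μ^(n-1)({g}) μ(g⁻¹A)`, the distribution at time `n` of the random walk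
with step distribution `μ` started at the identity. -/
noncomputable def convPow {G : Type*} [Group G] (μ : PMF G) : ℕ → PMF G
  | 0 => PMF.pure 1
  | n + 1 => (convPow μ n).bind fun g => μ.map fun s => g * s

theorem exists_list_prod_eq {G : Type*} [Group G] {S : Set G} (hSsymm : ∀ s ∈ S, s⁻¹ ∈ S)
    (hSgen : Subgroup.closure S = ⊤) (g : G) :
    ∃ l : List G, (∀ x ∈ l, x ∈ S) ∧ l.length = wordLength S g ∧ l.prod = g := by
  have hg : g ∈ Subgroup.closure S := hSgen ▸ Subgroup.mem_top g
  rw [← Subgroup.mem_toSubmonoid, Subgroup.closure_toSubmonoid] at hg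
  obtain ⟨l, hl, hprod⟩ := Submonoid.exists_list_of_mem_closure hg
  refine Nat.sInf_mem
    (s := {n : ℕ | ∃ l : List G, (∀ x ∈ l, x ∈ S) ∧ l.length = n ∧ l.prod = g})
    ⟨l.length, l, fun x hx => ?_, rfl, hprod⟩
  rcases hl x hx with h | h
  · exact h
  · simpa using hSsymm _ (Set.mem_inv.1 h)

theorem wordLength_prod_le {G : Type*} [Group G] {S : Set G} {l : List G}
    (hl : ∀ x ∈ l, x ∈ S) : wordLength S l.prod ≤ l.length :=
  Nat.sInf_le ⟨l, hl, rfl, rfl⟩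

theorem wordDist_le_add {G : Type*} [Group G] {S : Set G} (hSsymm : ∀ s ∈ S, s⁻¹ ∈ S)
    (hSgen : Subgroup.closure S = ⊤) (x y : G) :
    wordDist S x y ≤ wordLength S x + wordLength S y := by
  obtain ⟨l, hl, hlen, hx⟩ := exists_list_prod_eq hSsymm hSgen x
  obtain ⟨l', hl', hlen', hy⟩ := exists_list_prod_eq hSsymm hSgen y
  have hmem : ∀ z ∈ (l.map (·⁻¹)).reverse ++ l', z ∈ S := by
    intro z hz
    rcases List.mem_append.1 hz with h | h
    · obtain ⟨w, hw, rfl⟩ := List.mem_map.1 (List.mem_reverse.1 h)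
      exact hSsymm w (hl w hw)
    · exact hl' z h
  have h := wordLength_prod_le hmem
  rwa [List.prod_append, ← List.prod_inv_reverse, hx, hy, List.length_append, List.length_reverse,
    List.length_map, hlen, hlen'] at h

theorem wordDist_mul_left {G : Type*} [Group G] (S : Set G) (g x y : G) :
    wordDist S (g * x) (g * y) = wordDist S x y := by
  simp [wordDist, mul_assoc]

theorem convPow_add {G : Type*} [Group G] (μ : PMF G) (a b : ℕ) :
    convPow μ (a + b) = (convPow μ a).bind fun g => (convPow μ b).map fun h => g * h := by
  induction b with
  | zero => simp [convPow, PMF.pure_map]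
  | succ b ih =>
    rw [← add_assoc, convPow, ih, PMF.bind_bind]
    congr 1
    funext g
    rw [convPow, PMF.map_bind, PMF.bind_map]
    congr 1
    funext h
    simp [PMF.map_comp, Function.comp_def, mul_assoc]

theorem PMF.toOuterMeasure_le_iSup_add_compl {α : Type*} (p : PMF α) {Y B : Set α}
    (h : (Y ∩ B).Subsingleton) :
    p.toOuterMeasure Y ≤ (⨆ a ∈ B, p a) + p.toOuterMeasure Bᶜ := by
  calc p.toOuterMeasure Y
      ≤ p.toOuterMeasure (Y ∩ B ∪ Bᶜ) := by
        refine MeasureTheory.measure_mono fun a ha => ?_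
        by_cases hB : a ∈ B
        · exact Or.inl ⟨ha, hB⟩
        · exact Or.inr hB
    _ ≤ p.toOuterMeasure (Y ∩ B) + p.toOuterMeasure Bᶜ := MeasureTheory.measure_union_le _ _
    _ ≤ _ := by
        gcongr
        rcases h.eq_empty_or_singleton with h | ⟨a, h⟩
        · simp [h]
        · have ha : a ∈ B := (h.symm ▸ Set.mem_singleton a : a ∈ Y ∩ B).2
          rw [h, PMF.toOuterMeasure_apply_singleton]
          exact le_iSup₂ (f := fun a (_ : a ∈ B) => p a) a ha

theorem PMF.toOuterMeasure_bind_le {α β : Type*} (p : PMF α) (f : α → PMF β) (s : Set β)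
    {C : ℝ≥0∞} (h : ∀ a, (f a).toOuterMeasure s ≤ C) :
    (p.bind f).toOuterMeasure s ≤ C := by
  rw [PMF.toOuterMeasure_bind_apply]
  calc ∑' a, p a * (f a).toOuterMeasure s ≤ ∑' a, p a * C :=
        ENNReal.tsum_le_tsum fun a => by gcongr; exact h a
    _ = C := by rw [ENNReal.tsum_mul_right, p.tsum_coe, one_mul]

/-- If `X` is a `k`-separated subset of a countable group `G`, carrying the word metric of
a finite symmetric generating set `S`, then for all `m < n`,
`μ^(n)(X) ≤ sup { μ^(m)({g}) : g ∈ B_{k/2} } + μ^(m)(G \ B_{k/2})`,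
where `B_{k/2}` is the ball of radius `k/2` about the identity in the word metric. -/
theorem statement0 {G : Type*} [Group G] [Countable G]
    (S : Set G) (hSfin : S.Finite) (hSsymm : ∀ s ∈ S, s⁻¹ ∈ S)
    (hSgen : Subgroup.closure S = ⊤)
    (μ : PMF G) (k : ℝ) (hk : 0 < k)
    (X : Set G)
    (hsep : ∀ x ∈ X, ∀ y ∈ X, x ≠ y → k < (wordDist S x y : ℝ))
    (m n : ℕ) (hmn : m < n) :
    (convPow μ n).toOuterMeasure X ≤
      (⨆ g ∈ {g : G | (wordLength S g : ℝ) ≤ k / 2}, convPow μ m g) +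
        (convPow μ m).toOuterMeasure {g : G | (wordLength S g : ℝ) ≤ k / 2}ᶜ := by
  obtain ⟨a, rfl⟩ := Nat.exists_eq_add_of_le' hmn.le
  rw [convPow_add]
  refine PMF.toOuterMeasure_bind_le _ _ _ fun g => ?_
  rw [PMF.toOuterMeasure_map_apply]
  refine PMF.toOuterMeasure_le_iSup_add_compl _ ?_
  rintro x ⟨hxX, hx⟩ y ⟨hyX, hy⟩
  by_contra hne
  have hlt := hsep _ hxX _ hyX fun h => hne (mul_left_cancel h)
  rw [wordDist_mul_left] at hlt
  have hle : (wordDist S x y : ℝ) ≤ wordLength S x + wordLength S y := by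
    exact_mod_cast wordDist_le_add hSsymm hSgen x y
  simp only [Set.mem_ofPred_eq] at hx hy
  linarith
end

section
/- Let X be a geodesic metric space that is δ-hyperbolic (every geodesic triangle is δ-slim), let h : X → X be an isometry, and let α : ℝ → X be a geodesic line (an isometric embedding of ℝ) such that for every integer k and every t ∈ ℝ, the point h^k(α(t)) lies within distance 2δ of the image of α. Suppose there is a constant c > 0 such that d(x, h^n(x)) ≥ c·|n| for every x ∈ X and every integer n. Then for every x ∈ X and every positive integer n with n ≥ 8δ/c, the distance from x to the image of α satisfies d(x, image α) ≤ (n/2)·d(x, h(x)). -/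
/-- `γ` is a geodesic segment from `x` to `y`: it is parameterized by arclength on
`[0, dist x y]`, starting at `x` and ending at `y`. -/
def IsGeodesicSegment {X : Type*} [MetricSpace X] (γ : ℝ → X) (x y : X) : Prop :=
  γ 0 = x ∧ γ (dist x y) = y ∧
    ∀ s ∈ Set.Icc (0 : ℝ) (dist x y), ∀ t ∈ Set.Icc (0 : ℝ) (dist x y),
      dist (γ s) (γ t) = |s - t|

/-- `X` is a geodesic metric space: any two points are joined by a geodesic segment. -/
def GeodesicMetricSpace (X : Type*) [MetricSpace X] : Prop :=
  ∀ x y : X, ∃ γ : ℝ → X, IsGeodesicSegment γ x y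

/-- `X` is `δ`-hyperbolic (`δ`-slim triangles): every side of every geodesic triangle is
contained in the closed `δ`-neighbourhood of the union of the other two sides.  (Since
the quantification is over all vertices and all geodesics, and a reversed geodesic is a
geodesic, it suffices to require this for the side from `x` to `z`.) -/
def SlimTriangles (X : Type*) [MetricSpace X] (δ : ℝ) : Prop :=
  ∀ (x y z : X) (γ₁ γ₂ γ₃ : ℝ → X),
    IsGeodesicSegment γ₁ x y → IsGeodesicSegment γ₂ y z → IsGeodesicSegment γ₃ x z →
    ∀ t ∈ Set.Icc (0 : ℝ) (dist x z),
      ∃ p ∈ γ₁ '' Set.Icc (0 : ℝ) (dist x y) ∪ γ₂ '' Set.Icc (0 : ℝ) (dist y z),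
        dist (γ₃ t) p ≤ δ

namespace IsGeodesicSegment

variable {X : Type*} [MetricSpace X] {γ : ℝ → X} {x y : X}

theorem symm (hγ : IsGeodesicSegment γ x y) :
    IsGeodesicSegment (fun t => γ (dist x y - t)) y x := by
  obtain ⟨h0, h1, h2⟩ := hγ
  refine ⟨by simpa using h1, by simpa [dist_comm y x] using h0, ?_⟩
  intro s hs t ht
  rw [dist_comm y x] at hs ht
  rw [h2 _ ⟨by linarith [hs.2], by linarith [hs.1]⟩ _ ⟨by linarith [ht.2], by linarith [ht.1]⟩,
    abs_sub_comm]
  congr 1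
  ring

theorem comp_isometryEquiv (hγ : IsGeodesicSegment γ x y) (g : X ≃ᵢ X) :
    IsGeodesicSegment (fun t => g (γ t)) (g x) (g y) := by
  obtain ⟨h0, h1, h2⟩ := hγ
  refine ⟨by simp [h0], by simp [g.dist_eq, h1], ?_⟩
  simpa [g.dist_eq] using h2

theorem dist_left (hγ : IsGeodesicSegment γ x y) {t : ℝ} (ht : t ∈ Set.Icc 0 (dist x y)) :
    dist x (γ t) = t := by
  have := hγ.2.2 0 ⟨le_rfl, dist_nonneg⟩ t ht
  rw [hγ.1] at this
  rw [this, zero_sub, abs_neg, abs_of_nonneg ht.1]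

theorem dist_right (hγ : IsGeodesicSegment γ x y) {t : ℝ} (ht : t ∈ Set.Icc 0 (dist x y)) :
    dist (γ t) y = dist x y - t := by
  have := hγ.2.2 t ht (dist x y) ⟨dist_nonneg, le_rfl⟩
  rw [hγ.2.1] at this
  rw [this, abs_sub_comm, abs_of_nonneg (by linarith [ht.2])]

theorem isCompact_image (hγ : IsGeodesicSegment γ x y) :
    IsCompact (γ '' Set.Icc 0 (dist x y)) := by
  refine isCompact_Icc.image_of_continuousOn ?_
  refine (LipschitzOnWith.of_dist_le_mul (K := 1) ?_).continuousOn
  intro s hs t ht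
  rw [hγ.2.2 s hs t ht, Real.dist_eq]
  simp

/-- A point close to a geodesic segment almost realises equality in the triangle inequality. -/
theorem dist_add_dist_le (hγ : IsGeodesicSegment γ x y) {t ε : ℝ}
    (ht : t ∈ Set.Icc 0 (dist x y)) {b : X} (hb : dist b (γ t) ≤ ε) :
    dist x b + dist b y ≤ dist x y + 2 * ε := by
  have h1 := hγ.dist_left ht
  have h2 := hγ.dist_right ht
  have h3 := dist_triangle x (γ t) b
  have h4 := dist_triangle b (γ t) y
  rw [dist_comm (γ t) b] at h3
  linarith

end IsGeodesicSegment

/-- If `b, b'` are aligned between `A` and `B`, far apart, with `b` close to `[x, B]` and `b'`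
close to `[y, A]`, then `[x, y]` passes near both of them in this order. -/
theorem SlimTriangles.dist_add_dist_le_of_aligned {X : Type*} [MetricSpace X] {δ : ℝ}
    (hgeo : GeodesicMetricSpace X) (hslim : SlimTriangles X δ)
    {x y b b' A B : X} (hpos : 0 < dist b b') (hbb : 8 * δ ≤ dist b b')
    (hB : dist b b' + dist b' B ≤ dist b B + 4 * δ)
    (hA : dist b b' + dist b A ≤ dist b' A + 4 * δ)
    {β β' : ℝ → X} (hβ : IsGeodesicSegment β x B) (hβ' : IsGeodesicSegment β' y A)
    {t t' : ℝ} (ht : t ∈ Set.Icc 0 (dist x B)) (ht' : t' ∈ Set.Icc 0 (dist y A))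
    (hbt : dist b (β t) ≤ δ) (hbt' : dist b' (β' t') ≤ δ) :
    dist x b + dist y b' ≤ dist x y := by
  obtain ⟨γ, hγ⟩ := hgeo x y
  have hxB := hβ.dist_add_dist_le ht hbt
  have hyA := hβ'.dist_add_dist_le ht' hbt'
  have hxB' := dist_triangle x b' B
  have hyA' := dist_triangle y b A
  have hw : ∃ w ∈ Set.Icc 0 (dist x y), dist b (γ w) ≤ 2 * δ := by
    obtain ⟨η, hη⟩ := hgeo y B
    obtain ⟨p, hp | hp, hd⟩ := hslim x y B γ η β hγ hη hβ t ht
    · obtain ⟨w, hw, rfl⟩ := hp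
      exact ⟨w, hw, by linarith [dist_triangle b (β t) (γ w)]⟩
    · obtain ⟨u, hu, rfl⟩ := hp
      have h1 := hη.dist_add_dist_le (ε := 2 * δ) hu (b := b)
        (by linarith [dist_triangle b (β t) (η u)])
      linarith [dist_triangle y b' B]
  have hw' : ∃ w ∈ Set.Icc 0 (dist x y), dist b' (γ w) ≤ 2 * δ := by
    obtain ⟨η, hη⟩ := hgeo x A
    obtain ⟨p, hp | hp, hd⟩ := hslim y x A _ η β' hγ.symm hη hβ' t' ht'
    · obtain ⟨w, hw, rfl⟩ := hp
      rw [dist_comm y x] at hw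
      exact ⟨dist x y - w, ⟨by linarith [hw.2], by linarith [hw.1]⟩,
        (dist_triangle b' (β' t') _).trans (by linarith)⟩
    · obtain ⟨u, hu, rfl⟩ := hp
      have h1 := hη.dist_add_dist_le (ε := 2 * δ) hu (b := b')
        (by linarith [dist_triangle b' (β' t') (η u)])
      linarith [dist_triangle x b A]
  obtain ⟨w, hw, hbw⟩ := hw
  obtain ⟨w', hw', hbw'⟩ := hw'
  have h1 := hγ.dist_left hw
  have h2 := hγ.dist_left hw'
  have h3 := hγ.dist_right hw'
  have h4 := hγ.2.2 w hw w' hw'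
  have h5 : dist b b' ≤ dist b (γ w) + dist (γ w) (γ w') + dist b' (γ w') := by
    rw [dist_comm b' (γ w')]
    exact dist_triangle4 _ _ _ _
  have h6 := dist_triangle_right x b (γ w)
  have h7 := dist_triangle_right y b' (γ w')
  rw [dist_comm y (γ w')] at h7
  rcases le_total w w' with hle | hle
  · rw [abs_of_nonpos (by linarith)] at h4
    linarith
  · rw [abs_of_nonneg (by linarith)] at h4
    have h8 := dist_triangle x b (γ w)
    have h9 := dist_triangle_right x b' (γ w')
    linarith

/-- Some point of a geodesic side `[α a, α e]` is `δ`-close to both other sides of a triangle. -/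
theorem SlimTriangles.exists_close_to_both_sides {X : Type*} [MetricSpace X] {δ : ℝ}
    (hδ : 0 ≤ δ) (hslim : SlimTriangles X δ) {α : ℝ → X}
    (hα : ∀ s t : ℝ, dist (α s) (α t) = |s - t|) {a e : ℝ} (hae : a ≤ e) {x : X}
    {β γ : ℝ → X} (hβ : IsGeodesicSegment β x (α a)) (hγ : IsGeodesicSegment γ x (α e)) :
    ∃ t ∈ Set.Icc a e, (∃ u ∈ Set.Icc 0 (dist x (α a)), dist (α t) (β u) ≤ δ) ∧
      ∃ u ∈ Set.Icc 0 (dist x (α e)), dist (α t) (γ u) ≤ δ := by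
  have hcont : Continuous α := (Isometry.of_dist_eq fun s t => by
    rw [hα, Real.dist_eq]).continuous
  have key : ∀ (z : X) (η : ℝ → X), IsGeodesicSegment η x z →
      IsClosed {t | ∃ u ∈ Set.Icc 0 (dist x z), dist (α t) (η u) ≤ δ} := by
    intro z η hη
    have hne : (η '' Set.Icc 0 (dist x z)).Nonempty := ⟨_, 0, ⟨le_rfl, dist_nonneg⟩, rfl⟩
    have : {t | ∃ u ∈ Set.Icc 0 (dist x z), dist (α t) (η u) ≤ δ} =
        {t | Metric.infDist (α t) (η '' Set.Icc 0 (dist x z)) ≤ δ} := by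
      ext t
      constructor
      · rintro ⟨u, hu, hd⟩
        exact (Metric.infDist_le_dist_of_mem (Set.mem_image_of_mem η hu)).trans hd
      · intro ht
        obtain ⟨_, ⟨u, hu, rfl⟩, hd⟩ := hη.isCompact_image.exists_infDist_eq_dist hne (α t)
        exact ⟨u, hu, hd ▸ ht⟩
    rw [this]
    exact isClosed_le ((Metric.continuous_infDist_pt _).comp hcont) continuous_const
  have hlen : dist (α a) (α e) = e - a := by
    rw [hα, abs_sub_comm, abs_of_nonneg (by linarith)]
  have hside : IsGeodesicSegment (fun t => α (a + t)) (α a) (α e) := by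
    refine ⟨by simp, by simp [hlen], fun s _ t _ => ?_⟩
    rw [hα]
    congr 1
    ring
  obtain ⟨t, ht, hP, hQ⟩ := isPreconnected_closed_iff.1 (isPreconnected_Icc (a := a) (b := e))
    _ _ (key _ _ hβ) (key _ _ hγ) (by
      intro t ht
      obtain ⟨p, hp | hp, hd⟩ := hslim _ _ _ _ _ _ hβ.symm hγ hside (t - a)
        ⟨by linarith [ht.1], by rw [hlen]; linarith [ht.2]⟩
      · obtain ⟨u, hu, rfl⟩ := hp
        rw [dist_comm (α a) x] at hu
        left
        refine ⟨dist x (α a) - u, ⟨by linarith [hu.2], by linarith [hu.1]⟩, ?_⟩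
        simpa using hd
      · obtain ⟨u, hu, rfl⟩ := hp
        right
        exact ⟨u, hu, by simpa using hd⟩)
    ⟨a, ⟨le_rfl, hae⟩, dist x (α a), ⟨dist_nonneg, le_rfl⟩, by rw [hβ.2.1]; simpa⟩
    ⟨e, ⟨hae, le_rfl⟩, dist x (α e), ⟨dist_nonneg, le_rfl⟩, by rw [hγ.2.1]; simpa⟩
  exact ⟨t, ht, hP, hQ⟩

/-- A point `b` close to `α s` is aligned with `α t` and `α e` when `s` lies between `t`
and `e`. -/
theorem dist_add_dist_le_of_close_to_line {X : Type*} [MetricSpace X] {α : ℝ → X}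
    (hα : ∀ s t : ℝ, dist (α s) (α t) = |s - t|) {t s e ε : ℝ}
    (hs : t ≤ s ∧ s ≤ e ∨ e ≤ s ∧ s ≤ t) {b : X} (hb : dist b (α s) ≤ ε) :
    dist (α t) b + dist b (α e) ≤ dist (α t) (α e) + 2 * ε := by
  have h1 := dist_triangle_right (α t) b (α s)
  have h2 := dist_triangle b (α s) (α e)
  have h3 : |t - s| + |s - e| = |t - e| := by
    rcases hs with ⟨h, h'⟩ | ⟨h, h'⟩
    · rw [abs_of_nonpos (by linarith), abs_of_nonpos (by linarith), abs_of_nonpos (by linarith)]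
      ring
    · rw [abs_of_nonneg (by linarith), abs_of_nonneg (by linarith), abs_of_nonneg (by linarith)]
      ring
  rw [hα] at h1 h2 ⊢
  linarith

/-- An isometry `g` moving points of a quasi-axis `α` by at least `8δ` moves every point `x` by at
least twice its distance to `α`. -/
theorem SlimTriangles.two_mul_infDist_le {X : Type*} [MetricSpace X] {δ : ℝ} (hδ : 0 ≤ δ)
    (hgeo : GeodesicMetricSpace X) (hslim : SlimTriangles X δ) (g : X ≃ᵢ X) {α : ℝ → X}
    (hα : ∀ s t : ℝ, dist (α s) (α t) = |s - t|)
    (hg : ∀ t, ∃ s, dist (g (α t)) (α s) ≤ 2 * δ)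
    (hg' : ∀ t, ∃ s, dist (g.symm (α t)) (α s) ≤ 2 * δ)
    {ℓ : ℝ} (hℓ : 0 < ℓ) (hδℓ : 8 * δ ≤ ℓ) (h1 : ∀ x, ℓ ≤ dist x (g x))
    (h2 : ∀ x, 2 * ℓ ≤ dist x (g (g x))) (x : X) :
    2 * Metric.infDist x (Set.range α) ≤ dist x (g x) := by
  set R := dist x (α 0) with hR
  have hR0 : 0 ≤ R := dist_nonneg
  have hL0 : 0 ≤ dist x (g x) := dist_nonneg
  obtain ⟨T, hT⟩ : ∃ T, T = 4 * R + 8 * δ + dist x (g x) := ⟨_, rfl⟩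
  have hT0 : 0 ≤ T := by rw [hT]; positivity
  obtain ⟨β, hβ⟩ := hgeo x (α (-T))
  obtain ⟨γ, hγ⟩ := hgeo x (α T)
  obtain ⟨t, ht, ⟨u, hu, hbu⟩, ⟨v, hv, hbv⟩⟩ :=
    hslim.exists_close_to_both_sides hδ hα (by linarith : -T ≤ T) hβ hγ
  obtain ⟨s, hs⟩ := hg t
  obtain ⟨r, hr⟩ := hg' t
  have hgr : dist (α t) (g (α r)) ≤ 2 * δ := by
    rw [← g.symm.dist_eq]
    simpa using hr
  have hbx : dist x (α t) ≤ R + 2 * δ := by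
    have e1 := hβ.dist_add_dist_le hu hbu
    have e2 := hγ.dist_add_dist_le hv hbv
    have e3 := dist_triangle x (α 0) (α (-T))
    have e4 := dist_triangle x (α 0) (α T)
    have e5 : dist (α t) (α (-T)) = t + T := by
      rw [hα, abs_of_nonneg (by linarith [ht.1])]; ring
    have e6 : dist (α t) (α T) = T - t := by
      rw [hα, abs_of_nonpos (by linarith [ht.2])]; ring
    have e7 : dist (α 0) (α (-T)) = T := by
      rw [hα, abs_of_nonneg (by linarith)]; ring
    have e8 : dist (α 0) (α T) = T := by
      rw [hα, abs_of_nonpos (by linarith)]; ring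
    linarith
  have htb : |t| ≤ 2 * R + 2 * δ := by
    have := dist_triangle_left (α t) (α 0) x
    rw [hα, sub_zero] at this
    linarith
  have hmove : dist (α t) (g (α t)) ≤ 2 * R + 4 * δ + dist x (g x) := by
    have := dist_triangle4 (α t) x (g x) (g (α t))
    rw [g.dist_eq, dist_comm (α t) x] at this
    linarith
  have hmove' : dist (g.symm (α t)) (α t) = dist (α t) (g (α t)) := by
    rw [← g.dist_eq]
    simp
  have hst := dist_triangle (α t) (g (α t)) (α s)
  have hst' := dist_triangle_right (α t) (g (α t)) (α s)
  have hrt := dist_triangle_left (α r) (α t) (g.symm (α t))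
  have hrt' := dist_triangle (g.symm (α t)) (α r) (α t)
  rw [hα] at hst hst' hrt hrt'
  have hℓb := h1 (α t)
  have h2b := h2 (g.symm (α t))
  have hsr := dist_triangle4 (g.symm (α t)) (α r) (α s) (g (α t))
  rw [hα, dist_comm (α s)] at hsr
  simp only [IsometryEquiv.apply_symm_apply] at h2b
  have hinf : Metric.infDist x (Set.range α) ≤ dist x (α t) :=
    Metric.infDist_le_dist_of_mem (Set.mem_range_self t)
  suffices dist x (α t) + dist (g x) (g (α t)) ≤ dist x (g x) by
    rw [g.dist_eq] at this
    linarith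
  have hgα : ∀ s t : ℝ, dist (g (α s)) (g (α t)) = |s - t| := fun s t => by rw [g.dist_eq, hα]
  have hβg := hβ.comp_isometryEquiv g
  have hγg := hγ.comp_isometryEquiv g
  have hdir : t ≤ s ∧ r ≤ t ∨ s ≤ t ∧ t ≤ r := by
    by_contra! hcon
    rcases le_total t s with hts | hts
    · have hrt₁ := hcon.1 hts
      rw [abs_of_nonpos (by linarith)] at hst hst'
      rw [abs_of_nonneg (by linarith)] at hrt hrt'
      have : |r - s| ≤ 4 * δ := abs_le.2 ⟨by linarith, by linarith⟩
      linarith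
    · have hrt₁ := hcon.2 hts
      rw [abs_of_nonneg (by linarith)] at hst hst'
      rw [abs_of_nonpos (by linarith)] at hrt hrt'
      have : |r - s| ≤ 4 * δ := abs_le.2 ⟨by linarith, by linarith⟩
      linarith
  have hsT : -T ≤ s ∧ s ≤ T := by
    obtain ⟨a1, a2⟩ := abs_le.1 htb
    obtain ⟨a3, a4⟩ := abs_le.1 (hst.trans (add_le_add hmove hs))
    constructor <;> linarith
  have hrT : -T ≤ r ∧ r ≤ T := by
    obtain ⟨a1, a2⟩ := abs_le.1 htb
    obtain ⟨a3, a4⟩ := abs_le.1 (hrt.trans (add_le_add hr (hmove'.le.trans hmove)))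
    constructor <;> linarith
  rcases hdir with ⟨hts, hrt₁⟩ | ⟨hts, hrt₁⟩
  · have e1 := dist_add_dist_le_of_close_to_line hα (e := T) (Or.inl ⟨hts, hsT.2⟩) hs
    have e2 := dist_add_dist_le_of_close_to_line hgα (e := -T) (Or.inr ⟨hrT.1, hrt₁⟩) hgr
    rw [dist_comm (g (α t)) (α t)] at e2
    exact hslim.dist_add_dist_le_of_aligned hgeo (by linarith) (by linarith) (by linarith)
      (by linarith) hγ hβg (t' := u) hv (by rwa [g.dist_eq]) hbv (by rwa [g.dist_eq])
  · have e1 := dist_add_dist_le_of_close_to_line hα (e := -T) (Or.inr ⟨hsT.1, hts⟩) hs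
    have e2 := dist_add_dist_le_of_close_to_line hgα (e := T) (Or.inl ⟨hrt₁, hrT.2⟩) hgr
    rw [dist_comm (g (α t)) (α t)] at e2
    exact hslim.dist_add_dist_le_of_aligned hgeo (by linarith) (by linarith) (by linarith)
      (by linarith) hβ hγg (t' := v) hu (by rwa [g.dist_eq]) hbu (by rwa [g.dist_eq])

theorem IsometryEquiv.dist_pow_apply_le {X : Type*} [MetricSpace X] (h : X ≃ᵢ X) (x : X) (n : ℕ) :
    dist x ((h ^ n) x) ≤ n * dist x (h x) := by
  induction n with
  | zero => simp
  | succ k ih =>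
    have e1 := dist_triangle x ((h ^ k) x) ((h ^ (k + 1)) x)
    have e2 : dist ((h ^ k) x) ((h ^ (k + 1)) x) = dist x (h x) := by
      rw [pow_succ, IsometryEquiv.mul_apply, IsometryEquiv.dist_eq]
    push_cast
    linarith

/-- Let `X` be a geodesic `δ`-hyperbolic metric space, `h` an isometry of `X`, and
`α : ℝ → X` a geodesic line such that `h^k α` stays within `2δ` of `α` for every `k ∈ ℤ`.
If `d(x, h^n x) ≥ c |n|` for all `x` and `n`, then for every `x` and every positive
integer `n ≥ 8δ/c` one has `d(x, image α) ≤ (n/2) · d(x, h x)`. -/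
theorem statement5 {X : Type*} [MetricSpace X]
    (δ : ℝ) (hδ : 0 ≤ δ) (hgeo : GeodesicMetricSpace X) (hslim : SlimTriangles X δ)
    (h : X ≃ᵢ X)
    (α : ℝ → X) (hα : ∀ s t : ℝ, dist (α s) (α t) = |s - t|)
    (hfellow : ∀ (k : ℤ) (t : ℝ), ∃ s : ℝ, dist ((h ^ k) (α t)) (α s) ≤ 2 * δ)
    (c : ℝ) (hc : 0 < c)
    (htrans : ∀ (x : X) (n : ℤ), c * |(n : ℝ)| ≤ dist x ((h ^ n) x)) :
    ∀ (x : X) (n : ℕ), 0 < n → 8 * δ / c ≤ (n : ℝ) →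
      Metric.infDist x (Set.range α) ≤ ((n : ℝ) / 2) * dist x (h x) := by
  intro x n hn hδn
  have hn' : (0 : ℝ) < n := by exact_mod_cast hn
  have key := hslim.two_mul_infDist_le hδ hgeo (h ^ n) hα
    (fun t => by simpa using hfellow n t)
    (fun t => by
      obtain ⟨s, hs⟩ := hfellow (-n) t
      rw [zpow_neg, zpow_natCast] at hs
      exact ⟨s, hs⟩)
    (ℓ := c * n) (by positivity) (by rw [div_le_iff₀ hc] at hδn; linarith)
    (fun y => by simpa using htrans y n)
    (fun y => by
      have := htrans y ((n + n : ℕ) : ℤ)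
      rw [zpow_natCast, pow_add, IsometryEquiv.mul_apply] at this
      push_cast at this
      rw [abs_of_pos (by positivity)] at this
      linarith) x
  have := h.dist_pow_apply_le x n
  linarith
end
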